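/- Assume dim H ≥ 3. Let φ: P(H) → P(H) be a map satisfying ‖φ(P) − φ(Q)‖ ≤ ‖P − Q‖ for all P, Q ∈ P(H), and assume there exists a COSP {Q_α : α ∈ J} ⊆ P(H) such that {φ(Q_α) : α ∈ J} is a COSP in P(H). Then either φ is a Wigner symmetry, or there exist unitary operators U, V: H → H such that φ(P) = V Φ(U P U*) V* for all P ∈ P(H), where Φ is the map associated with some orthonormal basis of H. -/

import Mathlib

open scoped InnerProductSpace ComplexConjugate

variable {H : Type*} [NormedAddCommGroup H] [InnerProductSpace ℂ H] [CompleteSpace H]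

/-- The rank-one (orthogonal) projection onto the span of a unit vector `v`,
i.e. `x ↦ ⟪v, x⟫ • v`. -/
noncomputable def rankOneProj (v : H) : H →L[ℂ] H :=
  (innerSL ℂ v).smulRight v

/-- A rank-one projection: a self-adjoint idempotent bounded operator with
one-dimensional range. -/
def IsRankOneProjection (P : H →L[ℂ] H) : Prop :=
  IsSelfAdjoint P ∧ P ∘L P = P ∧ Module.finrank ℂ (LinearMap.range (P : H →ₗ[ℂ] H)) = 1

/-- Given a Hilbert basis `b = {e_α}` and a vector `v = Σ c_α e_α`, the associated vector
`Σ |c_α| e_α`.  The map `Φ` associated with `b` sends the rank-one projection onto `ℂ v`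
(for a unit vector `v`) to the rank-one projection onto `ℂ (absVec b v)`. -/
noncomputable def absVec {ι : Type*} (b : HilbertBasis ι ℂ H) (v : H) : H :=
  b.repr.symm ⟨fun α => (‖b.repr v α‖ : ℂ), by
    apply memℓp_gen
    have h := ((b.repr v).property).summable
      (by norm_num : (0 : ℝ) < (2 : ENNReal).toReal)
    refine h.congr fun α => ?_
    simp [Complex.norm_real]⟩

/-- `φ` is a Wigner symmetry: there is a unitary or antiunitary operator `U` on `H`
(an additive, norm-preserving, surjective map that is `ℂ`-linear or conjugate-linear)
such that `φ P = U P U*` for every rank-one projection `P`; equivalently, `φ` sends the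
projection onto `ℂv` to the projection onto `ℂ(Uv)` for every unit vector `v`. -/
def IsWignerSymmetry
    (φ : {P : H →L[ℂ] H // IsRankOneProjection P} → {P : H →L[ℂ] H // IsRankOneProjection P}) :
    Prop :=
  ∃ U : H → H,
    (∀ x y, U (x + y) = U x + U y) ∧
    (∀ x, ‖U x‖ = ‖x‖) ∧
    Function.Surjective U ∧
    ((∀ (c : ℂ) (x : H), U (c • x) = c • U x) ∨
      (∀ (c : ℂ) (x : H), U (c • x) = (starRingEnd ℂ) c • U x)) ∧
    (∀ (v : H), ‖v‖ = 1 → ∀ P : {P : H →L[ℂ] H // IsRankOneProjection P},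
      P.1 = rankOneProj v → (φ P).1 = rankOneProj (U v))

/-- A complete orthogonal system of rank-one projections (COSP): a pairwise-orthogonal
family such that no rank-one projection is orthogonal to every member. -/
def IsCOSP {J : Type*} (Q : J → {P : H →L[ℂ] H // IsRankOneProjection P}) : Prop :=
  (∀ α β, α ≠ β → (Q α).1 ∘L (Q β).1 = 0) ∧
  ∀ R : {P : H →L[ℂ] H // IsRankOneProjection P}, ∃ α, R.1 ∘L (Q α).1 ≠ 0

section Helpers

variable {E : Type*} [NormedAddCommGroup E] [InnerProductSpace ℂ E]

/-- A multiplicative one-parameter family of unit complex numbers whose real part dominates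
the cosine is continuous. -/
theorem continuous_of_cos_le_re {h : ℝ → ℂ} (hn : ∀ t, ‖h t‖ = 1)
    (hadd : ∀ s t, h (s + t) = h s * h t) (hre : ∀ t, Real.cos t ≤ (h t).re) :
    Continuous h := by
  have h0 : h 0 = 1 := by
    have := hadd 0 0
    have h0 : h 0 ≠ 0 := by
      intro h0
      simpa [h0] using hn 0
    rw [add_zero] at this
    exact (mul_eq_left₀ h0).1 this.symm
  have key : ∀ s t, ‖h s - h t‖ ^ 2 ≤ 2 - 2 * Real.cos (s - t) := by
    intro s t
    have e : h s - h t = (h (s - t) - 1) * h t := by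
      rw [sub_mul, ← hadd]; simp
    have n := hn (s - t)
    have n2 : (h (s - t)).re ^ 2 + (h (s - t)).im ^ 2 = 1 := by
      have := Complex.sq_norm (h (s - t))
      rw [n, Complex.normSq_apply] at this
      nlinarith
    rw [e, norm_mul, hn t, mul_one, Complex.sq_norm, Complex.normSq_apply]
    simp only [Complex.sub_re, Complex.one_re, Complex.sub_im, Complex.one_im]
    nlinarith [hre (s - t)]
  rw [continuous_iff_continuousAt]
  intro t
  rw [ContinuousAt, tendsto_iff_norm_sub_tendsto_zero]
  have lim : Filter.Tendsto (fun s => √(2 - 2 * Real.cos (s - t))) (nhds t) (nhds 0) := by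
    have : Continuous fun s => √(2 - 2 * Real.cos (s - t)) := by fun_prop
    simpa using this.tendsto t
  exact squeeze_zero (fun _ => norm_nonneg _) (fun s => Real.le_sqrt_of_sq_le (key s t)) lim

/-- Two multiplicative one-parameter families of unit complex numbers whose real parts dominate
the cosine coincide as soon as they agree at `π / 2`. -/
theorem eq_of_cos_le_re {h k : ℝ → ℂ} (hn : ∀ t, ‖h t‖ = 1) (kn : ∀ t, ‖k t‖ = 1)
    (hadd : ∀ s t, h (s + t) = h s * h t) (kadd : ∀ s t, k (s + t) = k s * k t)
    (hre : ∀ t, Real.cos t ≤ (h t).re) (kre : ∀ t, Real.cos t ≤ (k t).re)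
    (heq : h (Real.pi / 2) = k (Real.pi / 2)) : h = k := by
  have hne : ∀ t, h t ≠ 0 := fun t ht => by simpa [ht] using hn t
  have kne : ∀ t, k t ≠ 0 := fun t ht => by simpa [ht] using kn t
  have h0 : h 0 = 1 := (mul_eq_left₀ (hne 0)).1 (by rw [← hadd, add_zero])
  have k0 : k 0 = 1 := (mul_eq_left₀ (kne 0)).1 (by rw [← kadd, add_zero])
  let S : AddSubgroup ℝ :=
    { carrier := {t | h t = k t}
      add_mem' := fun {s t} hs ht => by
        simp only [Set.mem_ofPred_eq] at *
        rw [hadd, kadd, hs, ht]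
      zero_mem' := by simp [h0, k0]
      neg_mem' := fun {t} ht => by
        simp only [Set.mem_ofPred_eq] at *
        have h1 : h (-t) * h t = 1 := by rw [← hadd]; simp [h0]
        have k1 : k (-t) * k t = 1 := by rw [← kadd]; simp [k0]
        rw [ht] at h1
        exact mul_right_cancel₀ (kne t) (h1.trans k1.symm) }
  have mem : ∀ n : ℕ, Real.pi / 2 / 2 ^ n ∈ S := by
    intro n
    induction n with
    | zero => simpa using show Real.pi / 2 ∈ S from heq
    | succ n ih =>
      set t := Real.pi / 2 / 2 ^ (n + 1) with ht
      have htt : Real.pi / 2 / 2 ^ n = t + t := by rw [ht, pow_succ]; field_simp; norm_num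
      rw [htt] at ih
      have ih : h (t + t) = k (t + t) := ih
      rw [hadd, kadd] at ih
      have hcos : 0 < Real.cos t := by
        apply Real.cos_pos_of_mem_Ioo
        have : t < Real.pi / 2 := div_lt_self (by positivity) (one_lt_pow₀ (by norm_num) (by simp))
        have : 0 < t := by positivity
        constructor <;> linarith [Real.pi_pos]
      rcases mul_self_eq_mul_self_iff.1 ih with h1 | h1
      · exact h1
      · have := hre t
        have := kre t
        rw [h1, Complex.neg_re] at *
        linarith
  have hS : Dense (S : Set ℝ) := by
    refine AddSubgroup.dense_of_not_isolated_zero S fun ε hε => ?_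
    obtain ⟨n, hn⟩ := exists_pow_lt_of_lt_one (div_pos hε (by positivity : 0 < Real.pi / 2))
      (by norm_num : (1 / 2 : ℝ) < 1)
    refine ⟨_, mem n, by positivity, ?_⟩
    rw [lt_div_iff₀ (by positivity)] at hn
    calc Real.pi / 2 / 2 ^ n = (1 / 2) ^ n * (Real.pi / 2) := by
          rw [one_div, inv_pow]; field_simp
      _ < ε := hn
  exact Continuous.ext_on hS (continuous_of_cos_le_re hn hadd hre)
    (continuous_of_cos_le_re kn kadd kre) fun t ht => ht

/-- A multiplicative self-map of the unit circle whose real part dominates that of the identity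
is trivial, the identity, or the conjugation. -/
theorem circle_hom_trichotomy {g : ℂ → ℂ} (hn : ∀ z, ‖z‖ = 1 → ‖g z‖ = 1)
    (hmul : ∀ x y, ‖x‖ = 1 → ‖y‖ = 1 → g (x * y) = g x * g y)
    (hre : ∀ z, ‖z‖ = 1 → z.re ≤ (g z).re) :
    (∀ z, ‖z‖ = 1 → g z = 1) ∨ (∀ z, ‖z‖ = 1 → g z = z) ∨
      (∀ z, ‖z‖ = 1 → g z = conj z) := by
  have e1 (t : ℝ) : ‖Complex.exp (t * Complex.I)‖ = 1 := Complex.norm_exp_ofReal_mul_I t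
  have eadd (s t : ℝ) : Complex.exp ((s + t : ℝ) * Complex.I) =
      Complex.exp (s * Complex.I) * Complex.exp (t * Complex.I) := by
    rw [← Complex.exp_add]; push_cast; ring_nf
  set h : ℝ → ℂ := fun t => g (Complex.exp (t * Complex.I)) with hh
  have hn' : ∀ t, ‖h t‖ = 1 := fun t => hn _ (e1 t)
  have hadd' : ∀ s t, h (s + t) = h s * h t := fun s t => by
    rw [hh]; dsimp only; rw [eadd, hmul _ _ (e1 s) (e1 t)]
  have hre' : ∀ t, Real.cos t ≤ (h t).re := fun t => by
    have := hre _ (e1 t)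
    rwa [Complex.exp_ofReal_mul_I_re] at this
  have lift : ∀ {k : ℂ → ℂ}, (∀ z, ‖z‖ = 1 → ‖k z‖ = 1) →
      (∀ x y, k (x * y) = k x * k y) → (∀ z, ‖z‖ = 1 → z.re ≤ (k z).re) →
      g Complex.I = k Complex.I → ∀ z, ‖z‖ = 1 → g z = k z := by
    intro k kn kmul kre hk z hz
    have H : h = fun t : ℝ => k (Complex.exp (t * Complex.I)) := by
      refine eq_of_cos_le_re hn' (fun t => kn _ (e1 t)) hadd'
        (fun s t => by rw [eadd, kmul]) hre' (fun t => ?_) ?_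
      · have := kre _ (e1 t)
        rwa [Complex.exp_ofReal_mul_I_re] at this
      · simp only [hh]
        push_cast
        rw [Complex.exp_pi_div_two_mul_I]
        exact hk
    have := congrFun H z.arg
    simp only [hh] at this
    have hz' := Complex.norm_mul_exp_arg_mul_I z
    rw [hz, Complex.ofReal_one, one_mul] at hz'
    rwa [hz'] at this
  have g1 : g 1 = 1 := by
    have h1 : g 1 ≠ 0 := fun h1 => by simpa [h1] using hn 1 (by simp)
    exact (mul_eq_left₀ h1).1 (by rw [← hmul _ _ (by simp) (by simp), mul_one])
  have gI : (g Complex.I * g Complex.I) * (g Complex.I * g Complex.I) = 1 := by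
    rw [← hmul _ _ (by simp) (by simp), Complex.I_mul_I, ← hmul _ _ (by simp) (by simp)]
    simpa using g1
  have gIre : 0 ≤ (g Complex.I).re := by simpa using hre Complex.I (by simp)
  rcases mul_self_eq_one_iff.1 gI with h2 | h2
  · rcases mul_self_eq_one_iff.1 h2 with h3 | h3
    · left
      exact lift (k := fun _ => 1) (by simp) (by simp)
        (fun z hz => by simpa [hz] using Complex.re_le_norm z) h3
    · rw [h3] at gIre
      norm_num at gIre
  · right
    rw [← Complex.I_mul_I] at h2
    rcases mul_self_eq_mul_self_iff.1 h2 with h3 | h3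
    · left
      exact lift (k := fun z => z) (by simp) (by simp) (by simp) h3
    · right
      exact lift (k := fun z => conj z) (by simp) (by simp) (by simp) (by simpa using h3)

theorem rankOneProj_apply (v x : E) : rankOneProj v x = ⟪v, x⟫_ℂ • v := rfl

theorem isSelfAdjoint_rankOneProj (v : H) : IsSelfAdjoint (rankOneProj v) := by
  rw [ContinuousLinearMap.isSelfAdjoint_iff_isSymmetric]
  intro x y
  simp only [ContinuousLinearMap.coe_coe, rankOneProj_apply, inner_smul_left, inner_smul_right,
    inner_conj_symm]
  ring

theorem isRankOneProjection_rankOneProj {v : H} (hv : ‖v‖ = 1) :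
    IsRankOneProjection (rankOneProj v) := by
  have hvv : ⟪v, v⟫_ℂ = 1 := by simp [inner_self_eq_norm_sq_to_K, hv]
  refine ⟨isSelfAdjoint_rankOneProj v, ?_, ?_⟩
  · ext x
    rw [ContinuousLinearMap.comp_apply, rankOneProj_apply, rankOneProj_apply, inner_smul_right, hvv,
      mul_one]
  · have h : LinearMap.range (rankOneProj v : H →ₗ[ℂ] H) = ℂ ∙ v := by
      ext x
      rw [LinearMap.mem_range, Submodule.mem_span_singleton]
      constructor
      · rintro ⟨y, rfl⟩
        exact ⟨_, rfl⟩
      · rintro ⟨a, rfl⟩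
        exact ⟨a • v, by
          rw [ContinuousLinearMap.coe_coe, rankOneProj_apply, inner_smul_right, hvv, mul_one]⟩
    rw [h]
    exact finrank_span_singleton fun h0 => by simp [h0] at hv

theorem IsRankOneProjection.exists_eq_rankOneProj {P : H →L[ℂ] H} (hP : IsRankOneProjection P) :
    ∃ v : H, ‖v‖ = 1 ∧ P = rankOneProj v := by
  obtain ⟨hsa, hid, hr⟩ := hP
  obtain ⟨⟨w, hw⟩, hw0, hspan⟩ := finrank_eq_one_iff'.1 hr
  have hw0 : w ≠ 0 := fun h => hw0 (Subtype.ext h)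
  have hPw : P w = w := by
    obtain ⟨y, rfl⟩ := hw
    exact DFunLike.congr_fun hid y
  have hsym := ContinuousLinearMap.isSelfAdjoint_iff_isSymmetric.1 hsa
  have hv : ‖((‖w‖ : ℂ)⁻¹) • w‖ = 1 := by
    rw [norm_smul, norm_inv, Complex.norm_real, norm_norm, inv_mul_cancel₀ (norm_ne_zero_iff.2 hw0)]
  refine ⟨((‖w‖ : ℂ)⁻¹) • w, hv, ?_⟩
  set v := ((‖w‖ : ℂ)⁻¹) • w with hvdef
  have hPv : P v = v := by rw [hvdef, map_smul, hPw]
  have hvv : ⟪v, v⟫_ℂ = 1 := by simp [inner_self_eq_norm_sq_to_K, hv]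
  ext x
  obtain ⟨c, hc⟩ := hspan ⟨P x, x, rfl⟩
  have hc : c • w = P x := congrArg Subtype.val hc
  have hc' : P x = (c * ‖w‖) • v := by
    rw [hvdef, smul_smul, mul_assoc, mul_inv_cancel₀, mul_one, hc]
    exact_mod_cast norm_ne_zero_iff.2 hw0
  have h1 : ⟪v, P x⟫_ℂ = ⟪v, x⟫_ℂ := by
    have h := hsym v x
    simp only [ContinuousLinearMap.coe_coe] at h
    rw [← h, hPv]
  rw [hc', inner_smul_right, hvv, mul_one] at h1
  rw [hc', rankOneProj_apply, h1]

theorem norm_rankOneProj_sub_sq {u v : H} (hu : ‖u‖ = 1) (hv : ‖v‖ = 1) :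
    ‖rankOneProj u - rankOneProj v‖ ^ 2 = 1 - ‖⟪u, v⟫_ℂ‖ ^ 2 := by
  set A := rankOneProj u - rankOneProj v with hA
  have huu : ⟪u, u⟫_ℂ = 1 := by simp [inner_self_eq_norm_sq_to_K, hu]
  have hvv : ⟪v, v⟫_ℂ = 1 := by simp [inner_self_eq_norm_sq_to_K, hv]
  have hAx : ∀ x, A x = ⟪u, x⟫_ℂ • u - ⟪v, x⟫_ℂ • v := fun x => rfl
  have hle : ‖⟪u, v⟫_ℂ‖ ≤ 1 := by simpa [hu, hv] using norm_inner_le_norm (𝕜 := ℂ) u v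
  have hcc : ⟪u, v⟫_ℂ * ⟪v, u⟫_ℂ = (‖⟪u, v⟫_ℂ‖ ^ 2 : ℝ) := by
    rw [← inner_conj_symm v u, Complex.mul_conj, Complex.normSq_eq_norm_sq]
  set r : ℝ := 1 - ‖⟪u, v⟫_ℂ‖ ^ 2 with hr
  have hr0 : 0 ≤ r := by rw [hr]; nlinarith [norm_nonneg ⟪u, v⟫_ℂ]
  have hcc' : ⟪u, v⟫_ℂ * ⟪v, u⟫_ℂ = 1 - (r : ℂ) := by rw [hcc, hr]; push_cast; ring
  have hAAu : A (A u) = (r : ℂ) • u := by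
    simp only [hAx, inner_sub_right, inner_smul_right, huu, hvv]
    linear_combination (norm := module) (-hcc') • u
  have hAAv : A (A v) = (r : ℂ) • v := by
    simp only [hAx, inner_sub_right, inner_smul_right, huu, hvv]
    linear_combination (norm := module) (-hcc') • v
  have hsa : IsSelfAdjoint A := (isSelfAdjoint_rankOneProj u).sub (isSelfAdjoint_rankOneProj v)
  have hA3 : ∀ x, A (A (A x)) = (r : ℂ) • A x := by
    intro x
    rw [hAx x, map_sub, map_sub, map_smul, map_smul, map_smul, map_smul, hAAu, hAAv]
    module
  have hA4 : (A * A) * (A * A) = (r : ℂ) • (A * A) := by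
    ext x
    exact hA3 (A x)
  have hn2 : ‖A * A‖ = ‖A‖ ^ 2 := hsa.norm_mul_self
  have hn4 : ‖(A * A) * (A * A)‖ = ‖A * A‖ ^ 2 :=
    IsSelfAdjoint.norm_mul_self (by simpa [IsSelfAdjoint, star_mul] using by rw [hsa.star_eq])
  rw [hA4, norm_smul, hn2, Complex.norm_real, Real.norm_of_nonneg hr0, sq (‖A‖ ^ 2)] at hn4
  rcases eq_or_ne A 0 with h0 | h0
  · have hr' : r = 0 := by
      rw [h0] at hAAu
      have hu0 : u ≠ 0 := fun h => by simp [h] at hu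
      have := hAAu.symm
      simpa [hu0] using this
    rw [h0, hr']
    simp
  · exact (mul_right_cancel₀ (pow_ne_zero 2 (norm_ne_zero_iff.2 h0)) hn4).symm

/-- A rank-one projection is determined by its matrix entries in a Hilbert basis. -/
theorem rankOneProj_eq_of_repr {ι : Type*} (b : HilbertBasis ι ℂ E) {u v : E}
    (h : ∀ i j, b.repr u i * conj (b.repr u j) = b.repr v i * conj (b.repr v j)) :
    rankOneProj u = rankOneProj v := by
  refine ContinuousLinearMap.ext_on (s := Set.range b)
    (Submodule.dense_iff_topologicalClosure_eq_top.2 b.dense_span) ?_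
  rintro _ ⟨j, rfl⟩
  apply b.repr.injective
  ext i
  have := h i j
  simp only [b.repr_apply_apply, inner_conj_symm] at this
  simp only [rankOneProj_apply, b.repr_apply_apply, inner_smul_right]
  rw [mul_comm, this, mul_comm]

theorem repr_absVec {ι : Type*} (b : HilbertBasis ι ℂ E) (v : E) (i : ι) :
    b.repr (absVec b v) i = ‖b.repr v i‖ := by
  simp [absVec]

/-- Unit vectors spanning the ranges of a complete orthogonal system form a Hilbert basis. -/
theorem IsCOSP.exists_hilbertBasis {J : Type*}
    {Q : J → {P : H →L[ℂ] H // IsRankOneProjection P}} (hQ : IsCOSP Q) {e : J → H}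
    (he : ∀ j, ‖e j‖ = 1) (heQ : ∀ j, (Q j).1 = rankOneProj (e j)) :
    ∃ b : HilbertBasis J ℂ H, ∀ j, b j = e j := by
  have hee : ∀ j, ⟪e j, e j⟫_ℂ = 1 := fun j => by simp [inner_self_eq_norm_sq_to_K, he]
  have ne0 : ∀ j, e j ≠ 0 := fun j h => by simpa [h] using he j
  have hon : Orthonormal ℂ e := by
    refine ⟨he, fun i j hij => ?_⟩
    have h := DFunLike.congr_fun (hQ.1 i j hij) (e j)
    simp only [heQ, ContinuousLinearMap.comp_apply, rankOneProj_apply, hee, one_smul,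
      zero_apply] at h
    simpa [ne0] using h
  have hbot : (Submodule.span ℂ (Set.range e))ᗮ = ⊥ := by
    rw [Submodule.eq_bot_iff]
    intro x hx
    by_contra hx0
    have hex : ∀ j, ⟪x, e j⟫_ℂ = 0 := fun j =>
      Submodule.inner_left_of_mem_orthogonal (Submodule.subset_span (Set.mem_range_self j)) hx
    have hv : ‖((‖x‖ : ℂ)⁻¹) • x‖ = 1 := by
      rw [norm_smul, norm_inv, Complex.norm_real, norm_norm,
        inv_mul_cancel₀ (norm_ne_zero_iff.2 hx0)]
    obtain ⟨j, hj⟩ := hQ.2 ⟨_, isRankOneProjection_rankOneProj hv⟩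
    apply hj
    ext y
    simp [heQ, rankOneProj_apply, hex]
  exact ⟨HilbertBasis.mkOfOrthogonalEqBot hon hbot, fun j => by simp⟩

theorem HilbertBasis.three_le_mk {J : Type*} (b : HilbertBasis J ℂ E)
    (hdim : 3 ≤ Module.rank ℂ E) : 3 ≤ Cardinal.mk J := by
  rcases finite_or_infinite J with hJ | hJ
  · have := Fintype.ofFinite J
    have h := rank_eq_card_basis b.toOrthonormalBasis.toBasis
    rw [h] at hdim
    rw [Cardinal.mk_fintype]
    exact_mod_cast hdim
  · exact (Cardinal.natCast_le_aleph0 (n := 3)).trans (Cardinal.aleph0_le_mk J)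

/-- A family of self-maps of the unit circle indexed by ordered pairs that satisfies the cocycle
identity over at least three indices and increases real parts of correlations is, up to a
coboundary, a single map which is trivial, the identity, or the conjugation. -/
theorem exists_coboundary_of_cocycle {J : Type*} (hJ : 3 ≤ Cardinal.mk J) {f : J → J → ℂ → ℂ}
    (hn : ∀ i j z, i ≠ j → ‖z‖ = 1 → ‖f i j z‖ = 1)
    (hsymm : ∀ i j z, i ≠ j → ‖z‖ = 1 → f j i (conj z) = conj (f i j z))
    (hmul : ∀ i j k x y, i ≠ j → j ≠ k → i ≠ k → ‖x‖ = 1 → ‖y‖ = 1 →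
      f i j x * f j k y = f i k (x * y))
    (hre : ∀ i j z, i ≠ j → ‖z‖ = 1 → z.re ≤ (f i j z * conj (f i j 1)).re) :
    ∃ (d : J → ℂ) (g : ℂ → ℂ), (∀ i, ‖d i‖ = 1) ∧
      (∀ i j z, i ≠ j → ‖z‖ = 1 → f i j z = d i * conj (d j) * g z) ∧
      ((∀ z, ‖z‖ = 1 → g z = 1) ∨ (∀ z, ‖z‖ = 1 → g z = z) ∨
        (∀ z, ‖z‖ = 1 → g z = conj z)) := by
  classical
  have n1 : ‖(1 : ℂ)‖ = 1 := norm_one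
  have third : ∀ i j : J, ∃ k, k ≠ i ∧ k ≠ j := Cardinal.exists_ne_ne_of_three_le hJ
  have : Nonempty J := by
    rw [← Cardinal.mk_ne_zero_iff]
    rintro h
    simp [h] at hJ
  obtain ⟨o⟩ := this
  obtain ⟨p, hpo, -⟩ := third o o
  obtain ⟨q, hqo, hqp⟩ := third o p
  have unit_mul : ∀ {w : ℂ}, ‖w‖ = 1 → w * conj w = 1 := fun {w} hw => by
    rw [Complex.mul_conj, Complex.normSq_eq_norm_sq, hw]; simp
  have cne : ∀ i j, i ≠ j → f i j 1 ≠ 0 := fun i j hij h => by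
    simpa [h] using hn i j 1 hij n1
  have cc : ∀ i j, i ≠ j → f i j 1 * conj (f i j 1) = 1 := fun i j hij =>
    unit_mul (hn i j 1 hij n1)
  have row : ∀ i j k z, i ≠ j → i ≠ k → ‖z‖ = 1 →
      f i j z * conj (f i j 1) = f i k z * conj (f i k 1) := by
    intro i j k z hij hik hz
    rcases eq_or_ne j k with rfl | hjk
    · rfl
    have h1 := hmul i j k z 1 hij hjk hik hz n1
    have h2 := hmul i j k 1 1 hij hjk hik n1 n1
    rw [mul_one] at h1 h2
    rw [← h1, ← h2, map_mul]
    linear_combination (-f i j z * conj (f i j 1)) * cc j k hjk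
  have col : ∀ i j k z, i ≠ k → j ≠ k → ‖z‖ = 1 →
      f i k z * conj (f i k 1) = f j k z * conj (f j k 1) := by
    intro i j k z hik hjk hz
    rcases eq_or_ne i j with rfl | hij
    · rfl
    have h1 := hmul i j k 1 z hij hjk hik n1 hz
    have h2 := hmul i j k 1 1 hij hjk hik n1 n1
    rw [one_mul] at h1 h2
    rw [← h1, ← h2, map_mul]
    linear_combination (f j k z * conj (f j k 1)) * cc i j hij
  have const : ∀ i j i' j' z, i ≠ j → i' ≠ j' → ‖z‖ = 1 →
      f i j z * conj (f i j 1) = f i' j' z * conj (f i' j' 1) := by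
    intro i j i' j' z hij hij' hz
    obtain ⟨k, hki, hki'⟩ := third i i'
    rw [row i j k z hij hki.symm hz, col i i' k z hki.symm hki'.symm hz,
      row i' k j' z hki'.symm hij' hz]
  set g : ℂ → ℂ := fun z => f o p z * conj (f o p 1) with hg
  have fg : ∀ i j z, i ≠ j → ‖z‖ = 1 → f i j z = f i j 1 * g z := by
    intro i j z hij hz
    rw [hg]
    dsimp only
    rw [← const i j o p z hij hpo.symm hz]
    linear_combination (-f i j z) * cc i j hij
  have csymm : ∀ i j, i ≠ j → f j i 1 = conj (f i j 1) := fun i j hij => by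
    simpa using hsymm i j 1 hij n1
  refine ⟨fun i => if i = o then 1 else f i o 1, g, ?_, ?_, circle_hom_trichotomy ?_ ?_ ?_⟩
  · intro i
    dsimp only
    split_ifs with h
    · exact n1
    · exact hn i o 1 h n1
  · intro i j z hij hz
    rw [fg i j z hij hz]
    congr 1
    dsimp only
    split_ifs with hi hj hj
    · exact absurd (hi.trans hj.symm) hij
    · rw [hi, ← csymm j o hj, one_mul]
    · rw [hj, map_one, mul_one]
    · rw [← csymm j o hj, hmul i o j 1 1 hi (Ne.symm hj) hij n1 n1, mul_one]
  · intro z hz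
    simp only [hg, norm_mul, RCLike.norm_conj, hn o p _ hpo.symm hz, hn o p 1 hpo.symm n1, mul_one]
  · intro x y hx hy
    have hxy : ‖x * y‖ = 1 := by rw [norm_mul, hx, hy, one_mul]
    have h1 := hmul o p q x y hpo.symm hqp.symm hqo.symm hx hy
    have h2 := hmul o p q 1 1 hpo.symm hqp.symm hqo.symm n1 n1
    rw [fg o p x hpo.symm hx, fg p q y hqp.symm hy, fg o q _ hqo.symm hxy] at h1
    rw [mul_one] at h2
    rw [← h2] at h1
    apply mul_left_cancel₀ (mul_ne_zero (cne o p hpo.symm) (cne p q hqp.symm))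
    rw [← h1]
    ring
  · exact fun z hz => hre o p z hpo.symm hz

theorem HilbertBasis.norm_eq_one_of_sq_add {J : Type*} (b : HilbertBasis J ℂ E) {i j k : J}
    (hij : i ≠ j) (hjk : j ≠ k) (hik : i ≠ k) {x y z : ℂ}
    (h : ‖x‖ ^ 2 + ‖y‖ ^ 2 + ‖z‖ ^ 2 = 1) : ‖x • b i + y • b j + z • b k‖ = 1 := by
  have h1 := b.orthonormal.2 hij
  have h2 := b.orthonormal.2 hjk
  have h3 := b.orthonormal.2 hik
  have hn := b.orthonormal.1
  rw [← sq_eq_sq₀ (norm_nonneg _) zero_le_one, one_pow, ← h, sq,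
    norm_add_sq_eq_norm_sq_add_norm_sq_of_inner_eq_zero (𝕜 := ℂ),
    norm_add_sq_eq_norm_sq_add_norm_sq_of_inner_eq_zero (𝕜 := ℂ)]
  · simp [norm_smul, hn, sq]
  · simp [inner_smul_left, inner_smul_right, h1]
  · simp [inner_add_left, inner_smul_left, inner_smul_right, h2, h3]

theorem HilbertBasis.inner_eq_of_support_pair {J : Type*} (b : HilbertBasis J ℂ E) {i j : J}
    (hij : i ≠ j) {u : E} (hu : ∀ k, k ≠ i → k ≠ j → b.repr u k = 0) (v : E) :
    ⟪u, v⟫_ℂ = conj (b.repr u i) * b.repr v i + conj (b.repr u j) * b.repr v j := by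
  classical
  rw [← b.tsum_inner_mul_inner u v, tsum_eq_sum (s := {i, j}), Finset.sum_pair hij]
  · simp only [b.repr_apply_apply, inner_conj_symm]
  · intro k hk
    simp only [Finset.mem_insert, Finset.mem_singleton, not_or] at hk
    have := hu k hk.1 hk.2
    rw [b.repr_apply_apply] at this
    rw [← inner_conj_symm, this]
    simp

theorem HilbertBasis.hasSum_norm_repr_sq {J : Type*} (b : HilbertBasis J ℂ E) (v : E) :
    HasSum (fun i => ‖b.repr v i‖ ^ 2) (‖v‖ ^ 2) := by
  have h := lp.hasSum_norm (p := 2) (by norm_num) (b.repr v)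
  simpa using h

theorem Complex.normSq_conj_mul_add_conj_mul (x y a b : ℂ) :
    Complex.normSq (conj x * a + conj y * b) =
      Complex.normSq x * Complex.normSq a + Complex.normSq y * Complex.normSq b +
        2 * ((a * conj b) * conj (x * conj y)).re := by
  simp only [Complex.normSq_apply, Complex.add_re, Complex.add_im, Complex.mul_re, Complex.mul_im,
    Complex.conj_re, Complex.conj_im]
  ring

theorem Complex.eq_of_norm_eq_of_le_re {a w : ℂ} {r : ℝ} (ha : ‖a‖ = r) (hw : ‖w‖ = 1)
    (h : r ≤ (a * conj w).re) : a = r * w := by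
  have hr : 0 ≤ r := ha ▸ norm_nonneg a
  have ha2 : a.re ^ 2 + a.im ^ 2 = r ^ 2 := by
    rw [← ha, Complex.sq_norm, Complex.normSq_apply]; ring
  have hw2 : w.re ^ 2 + w.im ^ 2 = 1 := by
    have := Complex.sq_norm w
    rw [hw, Complex.normSq_apply] at this
    linarith
  simp only [Complex.mul_re, Complex.conj_re, Complex.conj_im] at h
  have key : (a.re - r * w.re) ^ 2 + (a.im - r * w.im) ^ 2 ≤ 0 := by
    nlinarith [mul_le_mul_of_nonneg_left h hr]
  apply Complex.ext
  · simp only [Complex.mul_re, Complex.ofReal_re, Complex.ofReal_im]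
    nlinarith [sq_nonneg (a.re - r * w.re), sq_nonneg (a.im - r * w.im)]
  · simp only [Complex.mul_im, Complex.ofReal_re, Complex.ofReal_im]
    nlinarith [sq_nonneg (a.re - r * w.re), sq_nonneg (a.im - r * w.im)]

section Correlation

variable {J : Type*} (b b' : HilbertBasis J ℂ E) {ψ : E → E}

theorem norm_repr_eq_of_le_inner (hψn : ∀ v, ‖v‖ = 1 → ‖ψ v‖ = 1)
    (hψ : ∀ u v, ‖u‖ = 1 → ‖v‖ = 1 → ‖⟪u, v⟫_ℂ‖ ≤ ‖⟪ψ u, ψ v⟫_ℂ‖) (hb : ∀ j, b' j = ψ (b j))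
    {v : E} (hv : ‖v‖ = 1) (j : J) : ‖b'.repr (ψ v) j‖ = ‖b.repr v j‖ := by
  have hle : ∀ i, ‖b.repr v i‖ ≤ ‖b'.repr (ψ v) i‖ := fun i => by
    rw [b.repr_apply_apply, b'.repr_apply_apply, hb]
    exact hψ _ _ (b.orthonormal.1 i) hv
  have h := (b'.hasSum_norm_repr_sq (ψ v)).sub (b.hasSum_norm_repr_sq v)
  rw [hψn v hv, hv, sub_self, hasSum_zero_iff_of_nonneg] at h
  · have hj := congrFun h j
    simp only [Pi.zero_apply, sub_eq_zero] at hj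
    exact (sq_eq_sq₀ (norm_nonneg _) (norm_nonneg _)).1 hj
  · intro i
    exact sub_nonneg.2 (pow_le_pow_left₀ (norm_nonneg _) (hle i) 2)

theorem re_le_re_of_le_inner (hψn : ∀ v, ‖v‖ = 1 → ‖ψ v‖ = 1)
    (hψ : ∀ u v, ‖u‖ = 1 → ‖v‖ = 1 → ‖⟪u, v⟫_ℂ‖ ≤ ‖⟪ψ u, ψ v⟫_ℂ‖) (hb : ∀ j, b' j = ψ (b j))
    {i j : J} (hij : i ≠ j) {u v : E} (hu : ‖u‖ = 1) (hv : ‖v‖ = 1)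
    (hsupp : ∀ k, k ≠ i → k ≠ j → b.repr u k = 0) :
    ((b.repr v i * conj (b.repr v j)) * conj (b.repr u i * conj (b.repr u j))).re ≤
      ((b'.repr (ψ v) i * conj (b'.repr (ψ v) j)) *
        conj (b'.repr (ψ u) i * conj (b'.repr (ψ u) j))).re := by
  have hN := fun {w : E} (hw : ‖w‖ = 1) k => norm_repr_eq_of_le_inner b b' hψn hψ hb hw k
  have hsupp' : ∀ k, k ≠ i → k ≠ j → b'.repr (ψ u) k = 0 := fun k hki hkj => by
    rw [← norm_eq_zero, hN hu, hsupp k hki hkj, norm_zero]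
  have h := pow_le_pow_left₀ (norm_nonneg _) (hψ u v hu hv) 2
  rw [b.inner_eq_of_support_pair hij hsupp, b'.inner_eq_of_support_pair hij hsupp',
    Complex.sq_norm, Complex.sq_norm, Complex.normSq_conj_mul_add_conj_mul,
    Complex.normSq_conj_mul_add_conj_mul] at h
  simp only [Complex.normSq_eq_norm_sq, hN hu, hN hv] at h
  linarith

/-- If `ψ` does not decrease the moduli of inner products of unit vectors and maps one Hilbert
basis to another, then, up to a coboundary, the matrix entries of the rank-one projections
transform by the modulus, the identity, or the conjugation. -/
theorem matrix_trichotomy_of_le_inner (hJ : 3 ≤ Cardinal.mk J)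
    (hψn : ∀ v, ‖v‖ = 1 → ‖ψ v‖ = 1)
    (hψ : ∀ u v, ‖u‖ = 1 → ‖v‖ = 1 → ‖⟪u, v⟫_ℂ‖ ≤ ‖⟪ψ u, ψ v⟫_ℂ‖) (hb : ∀ j, b' j = ψ (b j)) :
    ∃ d : J → ℂ, (∀ i, ‖d i‖ = 1) ∧
      ((∀ v, ‖v‖ = 1 → ∀ i j, b'.repr (ψ v) i * conj (b'.repr (ψ v) j) =
          d i * conj (d j) * (‖b.repr v i‖ * ‖b.repr v j‖ : ℝ)) ∨
        (∀ v, ‖v‖ = 1 → ∀ i j, b'.repr (ψ v) i * conj (b'.repr (ψ v) j) =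
          d i * conj (d j) * (b.repr v i * conj (b.repr v j))) ∨
        (∀ v, ‖v‖ = 1 → ∀ i j, b'.repr (ψ v) i * conj (b'.repr (ψ v) j) =
          d i * conj (d j) * conj (b.repr v i * conj (b.repr v j)))) := by
  classical
  have hN := fun {w : E} (hw : ‖w‖ = 1) k => norm_repr_eq_of_le_inner b b' hψn hψ hb hw k
  have third : ∀ i j : J, ∃ k, k ≠ i ∧ k ≠ j := Cardinal.exists_ne_ne_of_three_le hJ
  have hb1 := b.orthonormal.1
  have hbb := orthonormal_iff_ite.1 b.orthonormal
  set u : J → J → ℂ → E := fun i j z => (3 / 5 * z) • b i + (4 / 5 : ℂ) • b j with hu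
  have un : ∀ {i j z}, i ≠ j → ‖z‖ = 1 → ‖u i j z‖ = 1 := by
    intro i j z hij hz
    obtain ⟨k, hki, hkj⟩ := third i j
    have := b.norm_eq_one_of_sq_add hij hkj.symm hki.symm (x := 3 / 5 * z) (y := 4 / 5) (z := 0)
      (by simp [hz]; norm_num)
    simpa [hu] using this
  have ui : ∀ {i j z}, i ≠ j → b.repr (u i j z) i = 3 / 5 * z := by
    intro i j z hij
    rw [b.repr_apply_apply]
    simp [hu, inner_add_right, inner_smul_right, hbb, hb1, hij]
  have uj : ∀ {i j z}, i ≠ j → b.repr (u i j z) j = 4 / 5 := by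
    intro i j z hij
    rw [b.repr_apply_apply]
    simp [hu, inner_add_right, inner_smul_right, hbb, hb1, hij.symm]
  have uk : ∀ {i j z} k, k ≠ i → k ≠ j → b.repr (u i j z) k = 0 := by
    intro i j z k hki hkj
    rw [b.repr_apply_apply]
    simp [hu, inner_add_right, inner_smul_right, hbb, hki, hkj]
  set E' : E → J → J → ℂ := fun w i j => b'.repr w i * (starRingEnd ℂ) (b'.repr w j) with hE'
  set f : J → J → ℂ → ℂ := fun i j z => 25 / 12 * E' (ψ (u i j z)) i j with hf
  have fn : ∀ i j z, i ≠ j → ‖z‖ = 1 → ‖f i j z‖ = 1 := by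
    intro i j z hij hz
    simp only [hf, hE', norm_mul, RCLike.norm_conj, hN (un hij hz), ui hij, uj hij, hz]
    norm_num
  have key : ∀ {v i j} {z : ℂ} {r : ℝ}, ‖v‖ = 1 → i ≠ j → ‖z‖ = 1 →
      b.repr v i * (starRingEnd ℂ) (b.repr v j) = r * z → 0 ≤ r → E' (ψ v) i j = r * f i j z := by
    intro v i j z r hv hij hz hvz hr
    have h := re_le_re_of_le_inner b b' hψn hψ hb hij (un hij hz) hv uk
    have hnorm : ‖E' (ψ v) i j‖ = r := by
      have h1 := congrArg norm hvz
      rw [norm_mul, norm_mul, RCLike.norm_conj, hz, Complex.norm_real, Real.norm_of_nonneg hr,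
        mul_one] at h1
      rw [hE']
      dsimp only
      rw [norm_mul, RCLike.norm_conj, hN hv, hN hv, h1]
    refine Complex.eq_of_norm_eq_of_le_re hnorm (fn i j z hij hz) ?_
    have e1 : (r * z) * conj (3 / 5 * z * conj (4 / 5 : ℂ)) = ((12 / 25 * r : ℝ) : ℂ) := by
      have hzz : z * conj z = 1 := by
        rw [Complex.mul_conj, Complex.normSq_eq_norm_sq, hz]; simp
      simp only [map_mul, map_div₀, map_ofNat]
      push_cast
      linear_combination (12 / 25 * (r : ℂ)) * hzz
    have e2 : E' (ψ v) i j * conj (f i j z) =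
        ((25 / 12 : ℝ) : ℂ) * (E' (ψ v) i j * conj (E' (ψ (u i j z)) i j)) := by
      simp only [hf, map_mul, map_div₀, map_ofNat]
      push_cast
      ring
    rw [ui hij, uj hij, hvz, e1, Complex.ofReal_re] at h
    rw [e2, Complex.re_ofReal_mul]
    change _ ≤ (E' (ψ v) i j * conj (E' (ψ (u i j z)) i j)).re at h
    linarith
  have fre : ∀ i j z, i ≠ j → ‖z‖ = 1 → z.re ≤ (f i j z * conj (f i j 1)).re := by
    intro i j z hij hz
    have h := re_le_re_of_le_inner b b' hψn hψ hb hij (un hij norm_one) (un hij hz) uk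
    rw [ui hij, uj hij, ui hij, uj hij] at h
    change _ ≤ (E' (ψ (u i j z)) i j * conj (E' (ψ (u i j 1)) i j)).re at h
    have e1 : 3 / 5 * z * conj (4 / 5 : ℂ) * conj (3 / 5 * 1 * conj (4 / 5 : ℂ)) =
        ((144 / 625 : ℝ) : ℂ) * z := by
      simp only [map_mul, map_div₀, map_ofNat, map_one]
      push_cast
      ring
    have e2 : f i j z * conj (f i j 1) = ((625 / 144 : ℝ) : ℂ) *
        (E' (ψ (u i j z)) i j * conj (E' (ψ (u i j 1)) i j)) := by
      simp only [hf, map_mul, map_div₀, map_ofNat]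
      push_cast
      ring
    rw [e1, Complex.re_ofReal_mul] at h
    rw [e2, Complex.re_ofReal_mul]
    linarith
  have fsymm : ∀ i j z, i ≠ j → ‖z‖ = 1 → f j i (conj z) = conj (f i j z) := by
    intro i j z hij hz
    have h := key (z := conj z) (r := 12 / 25) (un hij hz) hij.symm (by simpa using hz)
      (by rw [ui hij, uj hij]; simp [map_ofNat]; ring) (by norm_num)
    have e : E' (ψ (u i j z)) j i = conj (E' (ψ (u i j z)) i j) := by
      simp [hE', mul_comm]
    rw [e] at h
    push_cast at h
    simp only [hf, map_mul, map_div₀, map_ofNat] at h ⊢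
    rw [h]
    ring
  have fmul : ∀ i j k x y, i ≠ j → j ≠ k → i ≠ k → ‖x‖ = 1 → ‖y‖ = 1 →
      f i j x * f j k y = f i k (x * y) := by
    intro i j k x y hij hjk hik hx hy
    set v : E := (1 / 3 * (x * y)) • b i + (2 / 3 * y) • b j + (2 / 3 : ℂ) • b k with hv
    have vn : ‖v‖ = 1 := b.norm_eq_one_of_sq_add hij hjk hik (by simp [hx, hy]; norm_num)
    have vi : b.repr v i = 1 / 3 * (x * y) := by
      rw [b.repr_apply_apply]
      simp [hv, inner_add_right, inner_smul_right, hbb, hb1, hij, hik]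
    have vj : b.repr v j = 2 / 3 * y := by
      rw [b.repr_apply_apply]
      simp [hv, inner_add_right, inner_smul_right, hbb, hb1, hij.symm, hjk]
    have vk : b.repr v k = 2 / 3 := by
      rw [b.repr_apply_apply]
      simp [hv, inner_add_right, inner_smul_right, hbb, hb1, hik.symm, hjk.symm]
    have hyy : y * conj y = 1 := by
      rw [Complex.mul_conj, Complex.normSq_eq_norm_sq, hy]; simp
    have h1 := key (r := 2 / 9) vn hij hx
      (by rw [vi, vj]; simp [map_ofNat]; linear_combination (2 / 9 * x) * hyy) (by norm_num)
    have h2 := key (r := 4 / 9) vn hjk hy (by rw [vj, vk]; simp [map_ofNat]; ring) (by norm_num)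
    have h3 := key (z := x * y) (r := 2 / 9) vn hik (by rw [norm_mul, hx, hy, one_mul])
      (by rw [vi, vk]; simp [map_ofNat]; ring) (by norm_num)
    have h4 : conj (b'.repr (ψ v) j) * b'.repr (ψ v) j = 4 / 9 := by
      rw [mul_comm, Complex.mul_conj, Complex.normSq_eq_norm_sq, hN vn, vj]
      simp [hy]
      norm_num
    simp only [hE'] at h1 h2 h3
    push_cast at h1 h2 h3
    have h5 := congrArg₂ (· * ·) h1 h2
    linear_combination (-81 / 8 : ℂ) * h5 + (9 / 2 : ℂ) * h3 +
      (81 / 8 : ℂ) * (b'.repr (ψ v) i * (starRingEnd ℂ) (b'.repr (ψ v) k)) * h4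
  obtain ⟨d, g, hd, hfd, hg⟩ := exists_coboundary_of_cocycle hJ fn fsymm fmul fre
  have dd : ∀ i, d i * conj (d i) = 1 := fun i => by
    rw [Complex.mul_conj, Complex.normSq_eq_norm_sq, hd]; simp
  have diag : ∀ {v}, ‖v‖ = 1 → ∀ i, b'.repr (ψ v) i * conj (b'.repr (ψ v) i) =
      (‖b.repr v i‖ * ‖b.repr v i‖ : ℝ) := fun {v} hv i => by
    rw [Complex.mul_conj, Complex.normSq_eq_norm_sq, hN hv, sq]
  have polar : ∀ w : ℂ, ∃ z : ℂ, ‖z‖ = 1 ∧ w = ‖w‖ * z := fun w =>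
    ⟨_, Complex.norm_exp_ofReal_mul_I w.arg, (Complex.norm_mul_exp_arg_mul_I w).symm⟩
  refine ⟨d, hd, ?_⟩
  rcases hg with hg | hg | hg
  · refine Or.inl fun v hv i j => ?_
    rcases eq_or_ne i j with rfl | hij
    · rw [dd, one_mul, diag hv]
    obtain ⟨z, hz, hw⟩ := polar (b.repr v i * conj (b.repr v j))
    have h := key hv hij hz hw (norm_nonneg _)
    rw [hfd i j z hij hz, hg z hz, norm_mul, RCLike.norm_conj] at h
    linear_combination h
  · refine Or.inr (Or.inl fun v hv i j => ?_)
    rcases eq_or_ne i j with rfl | hij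
    · rw [dd, one_mul, diag hv, Complex.mul_conj, Complex.normSq_eq_norm_sq, sq]
    obtain ⟨z, hz, hw⟩ := polar (b.repr v i * conj (b.repr v j))
    have h := key hv hij hz hw (norm_nonneg _)
    rw [hfd i j z hij hz, hg z hz] at h
    rw [hw]
    linear_combination h
  · refine Or.inr (Or.inr fun v hv i j => ?_)
    rcases eq_or_ne i j with rfl | hij
    · rw [dd, one_mul, diag hv, Complex.mul_conj, Complex.normSq_eq_norm_sq, sq, Complex.conj_ofReal]
    obtain ⟨z, hz, hw⟩ := polar (b.repr v i * conj (b.repr v j))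
    have h := key hv hij hz hw (norm_nonneg _)
    rw [hfd i j z hij hz, hg z hz] at h
    rw [hw, map_mul, Complex.conj_ofReal]
    linear_combination h

end Correlation

theorem rankOneProj_smul_of_norm_eq_one {d : ℂ} (hd : ‖d‖ = 1) (v : E) :
    rankOneProj (d • v) = rankOneProj v := by
  ext x
  rw [rankOneProj_apply, rankOneProj_apply, inner_smul_left, smul_smul, mul_right_comm,
    mul_comm (conj d), Complex.mul_conj, Complex.normSq_eq_norm_sq, hd]
  simp

/-- Coordinatewise conjugation of a square-summable family, as a vector expressed in a second
Hilbert basis. -/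
noncomputable def conjTransport {J : Type*} (b c : HilbertBasis J ℂ E) (v : E) : E :=
  c.repr.symm (star (b.repr v))

theorem repr_conjTransport {J : Type*} (b c : HilbertBasis J ℂ E) (v : E) (j : J) :
    c.repr (conjTransport b c v) j = conj (b.repr v j) := by
  simp [conjTransport]

end Helpers

/-- Theorem 1.5. Assume `dim H ≥ 3`.  Let `φ` be a nonexpansive map of the
set of rank-one projections mapping some COSP `{Q_α}` to a COSP.  Then either `φ` is a Wigner
symmetry, or there are unitary operators `U, V` on `H` and an orthonormal basis `b` of `H`
such that `φ(P) = V Φ(U P U*) V*` for all `P`, where `Φ` is the map associated with `b`. -/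
theorem nonexpansive_COSP_to_COSP_dichotomy
    (hdim : 3 ≤ Module.rank ℂ H)
    (φ : {P : H →L[ℂ] H // IsRankOneProjection P} → {P : H →L[ℂ] H // IsRankOneProjection P})
    (hne : ∀ P Q : {P : H →L[ℂ] H // IsRankOneProjection P},
      ‖(φ P).1 - (φ Q).1‖ ≤ ‖P.1 - Q.1‖)
    {J : Type*} (Q : J → {P : H →L[ℂ] H // IsRankOneProjection P})
    (hQ : IsCOSP Q) (hφQ : IsCOSP fun α => φ (Q α)) :
    IsWignerSymmetry φ ∨
      ∃ (b : HilbertBasis J ℂ H) (U V : H ≃ₗᵢ[ℂ] H),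
        ∀ (P : {P : H →L[ℂ] H // IsRankOneProjection P}) (v : H), ‖v‖ = 1 →
          P.1 = rankOneProj v →
            ∀ x : H, (φ P).1 (V x) = V (rankOneProj (absVec b (U v)) x) := by
  choose! rep hrepn hrep using fun (P : H →L[ℂ] H) (hP : IsRankOneProjection P) =>
    hP.exists_eq_rankOneProj
  have hψ : ∀ v : H, ∃ w : H, ‖v‖ = 1 → ‖w‖ = 1 ∧
      ∀ P : {P : H →L[ℂ] H // IsRankOneProjection P}, P.1 = rankOneProj v →
        (φ P).1 = rankOneProj w := by
    intro v
    by_cases hv : ‖v‖ = 1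
    · set R := φ ⟨rankOneProj v, isRankOneProjection_rankOneProj hv⟩ with hR
      refine ⟨rep R.1, fun _ => ⟨hrepn _ R.2, fun P hP => ?_⟩⟩
      rw [← hrep _ R.2, hR]
      congr 2
      exact Subtype.ext hP
    · exact ⟨0, fun h => absurd h hv⟩
  choose ψ hψ using hψ
  have hψn : ∀ v, ‖v‖ = 1 → ‖ψ v‖ = 1 := fun v hv => (hψ v hv).1
  have hψin : ∀ u v, ‖u‖ = 1 → ‖v‖ = 1 → ‖⟪u, v⟫_ℂ‖ ≤ ‖⟪ψ u, ψ v⟫_ℂ‖ := by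
    intro u v hu hv
    have h := hne ⟨_, isRankOneProjection_rankOneProj hu⟩ ⟨_, isRankOneProjection_rankOneProj hv⟩
    rw [(hψ u hu).2 _ rfl, (hψ v hv).2 _ rfl] at h
    have h2 := pow_le_pow_left₀ (norm_nonneg _) h 2
    rw [norm_rankOneProj_sub_sq hu hv, norm_rankOneProj_sub_sq (hψn u hu) (hψn v hv)] at h2
    exact le_of_sq_le_sq (by linarith) (norm_nonneg _)
  obtain ⟨b, hb⟩ := hQ.exists_hilbertBasis (e := fun j => rep (Q j).1)
    (fun j => hrepn _ (Q j).2) (fun j => hrep _ (Q j).2)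
  have hbQ : ∀ j, (Q j).1 = rankOneProj (b j) := fun j => (hrep _ (Q j).2).trans (by rw [hb])
  have hbn : ∀ j, ‖b j‖ = 1 := b.orthonormal.1
  have hφb : ∀ j, (φ (Q j)).1 = rankOneProj (ψ (b j)) := fun j => (hψ _ (hbn j)).2 _ (hbQ j)
  obtain ⟨b', hb'⟩ := hφQ.exists_hilbertBasis (e := fun j => ψ (b j)) (fun j => hψn _ (hbn j)) hφb
  obtain ⟨d, hd, hcases⟩ := matrix_trichotomy_of_le_inner b b' (b.three_le_mk hdim) hψn hψin hb'
  obtain ⟨c, hc⟩ := hφQ.exists_hilbertBasis (e := fun j => d j • ψ (b j))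
    (fun j => by rw [norm_smul, hd, hψn _ (hbn j), one_mul])
    (fun j => (hφb j).trans (rankOneProj_smul_of_norm_eq_one (hd j) _).symm)
  have hcr : ∀ w j, c.repr w j = conj (d j) * b'.repr w j := fun w j => by
    rw [c.repr_apply_apply, hc, b'.repr_apply_apply, hb', inner_smul_left]
  have dd : ∀ i, conj (d i) * d i = 1 := fun i => by
    rw [mul_comm, Complex.mul_conj, Complex.normSq_eq_norm_sq, hd]; simp
  have entry : ∀ {w i j} {a : ℂ}, b'.repr w i * (starRingEnd ℂ) (b'.repr w j) =
      d i * conj (d j) * a → c.repr w i * (starRingEnd ℂ) (c.repr w j) = a := by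
    intro w i j a h
    rw [hcr, hcr, map_mul, Complex.conj_conj]
    linear_combination (conj (d i) * d j) * h + a * (conj (d j) * d j) * dd i + a * dd j
  rcases hcases with h | h | h
  · refine Or.inr ⟨b, LinearIsometryEquiv.refl ℂ H, b.repr.trans c.repr.symm,
      fun P v hv hP x => ?_⟩
    set V : H ≃ₗᵢ[ℂ] H := b.repr.trans c.repr.symm with hV
    have hVr : ∀ w, c.repr (V w) = b.repr w := fun w => by simp [hV]
    have hproj : rankOneProj (ψ v) = rankOneProj (V (absVec b v)) := by
      refine rankOneProj_eq_of_repr c fun i j => (entry (h v hv i j)).trans ?_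
      rw [hVr, repr_absVec, repr_absVec, Complex.conj_ofReal]
      push_cast
      rfl
    rw [(hψ v hv).2 P hP, hproj, rankOneProj_apply, rankOneProj_apply,
      LinearIsometryEquiv.inner_map_map, map_smul]
    rfl
  · refine Or.inl ⟨b.repr.trans c.repr.symm, map_add _, LinearIsometryEquiv.norm_map _,
      LinearIsometryEquiv.surjective _, Or.inl (map_smul _), fun v hv P hP => ?_⟩
    rw [(hψ v hv).2 P hP]
    refine rankOneProj_eq_of_repr c fun i j => (entry (h v hv i j)).trans ?_
    simp
  · refine Or.inl ⟨conjTransport b c, fun x y => ?_, fun x => ?_, fun y => ?_,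
      Or.inr fun a x => ?_, fun v hv P hP => ?_⟩
    · simp [conjTransport]
    · simp [conjTransport]
    · exact ⟨conjTransport c b y, by simp [conjTransport]⟩
    · simp [conjTransport]
    · rw [(hψ v hv).2 P hP]
      refine rankOneProj_eq_of_repr c fun i j => (entry (h v hv i j)).trans ?_
      rw [repr_conjTransport, repr_conjTransport, map_mul]
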